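/- Let E ⊆ ℕA be the exponent set of a monomial ideal and F a face of A such that E has a standard pair belonging to F. Then there are only finitely many overlap classes of standard pairs of E belonging to F that are maximal with respect to divisibility; equivalently, any set of pairwise non-overlapping standard pairs of E belonging to F whose overlap classes are maximal with respect to divisibility is finite. -/

import Mathlib

open scoped BigOperators

namespace StdPairsPaper

/-- The coercion of a lattice point to a real vector. -/
def toR {d : ℕ} (v : Fin d → ℤ) : Fin d → ℝ := fun i => (v i : ℝ)

/-- The cone of nonnegative real combinations of (the real images of) elements of `S`. -/
def cone {d : ℕ} (S : Set (Fin d → ℤ)) : Set (Fin d → ℝ) :=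
  {x | ∃ (t : Finset (Fin d → ℤ)) (c : (Fin d → ℤ) → ℝ),
    (t : Set (Fin d → ℤ)) ⊆ S ∧ (∀ v, 0 ≤ c v) ∧ x = ∑ v ∈ t, c v • toR v}

/-- `ℕS`, the submonoid of `ℤ^d` generated by `S`. -/
def NSemi {d : ℕ} (S : Set (Fin d → ℤ)) : AddSubmonoid (Fin d → ℤ) :=
  AddSubmonoid.closure S

/-- `ℤS`, the subgroup of `ℤ^d` generated by `S`. -/
def ZGrp {d : ℕ} (S : Set (Fin d → ℤ)) : AddSubgroup (Fin d → ℤ) :=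
  AddSubgroup.closure S

/-- `ℝS`, the real linear span of `S`. -/
def RSpan {d : ℕ} (S : Set (Fin d → ℤ)) : Submodule ℝ (Fin d → ℝ) :=
  Submodule.span ℝ (toR '' S)

/-- `A` is a configuration: a finite set of nonzero lattice points whose `ℤ`-span is `ℤ^d`
and whose nonnegative real cone is strongly convex (contains no line, i.e. is pointed). -/
structure IsConfig {d : ℕ} (A : Set (Fin d → ℤ)) : Prop where
  (finite : A.Finite)
  (nonzero : (0 : Fin d → ℤ) ∉ A)
  (spans : ZGrp A = ⊤)
  (pointed : ∀ x ∈ cone A, -x ∈ cone A → x = 0)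

/-- `F` is a face of the configuration `A`: `F ⊆ A`, the cone over `F` is an extreme
subset (face) of the cone over `A`, and `ℝ_{≥0}F ∩ A = F`. -/
def IsFace {d : ℕ} (A F : Set (Fin d → ℤ)) : Prop :=
  F ⊆ A ∧ IsExtreme ℝ (cone A) (cone F) ∧ cone F ∩ (toR '' A) = toR '' F

/-- The set `a + ℕF`. -/
def cell {d : ℕ} (a : Fin d → ℤ) (F : Set (Fin d → ℤ)) : Set (Fin d → ℤ) :=
  {x | ∃ f ∈ NSemi F, x = a + f}

/-- Two pairs `(a,F)` and `(b,F)` belonging to the same face `F` overlap: `a - b ∈ ℤF`. -/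
def Overlap {d : ℕ} (F : Set (Fin d → ℤ)) (a b : Fin d → ℤ) : Prop :=
  a - b ∈ ZGrp F

/-- The pair `(a,F)` divides the pair `(b,G)`:
there is `c ∈ ℕA` with `a + c + ℕF ⊆ b + ℕG`. -/
def PairDvd {d : ℕ} (A : Set (Fin d → ℤ)) (a : Fin d → ℤ) (F : Set (Fin d → ℤ))
    (b : Fin d → ℤ) (G : Set (Fin d → ℤ)) : Prop :=
  ∃ c ∈ NSemi A, cell (a + c) F ⊆ cell b G

/-- `E` is the exponent set of a monomial ideal of `ℕA`: `E ⊆ ℕA` and `E + ℕA ⊆ E`. -/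
def IsExpSet {d : ℕ} (A E : Set (Fin d → ℤ)) : Prop :=
  E ⊆ (NSemi A : Set (Fin d → ℤ)) ∧ ∀ e ∈ E, ∀ c ∈ NSemi A, e + c ∈ E

/-- The standard monomials of `E`: `ℕA ∖ E`. -/
def stdSet {d : ℕ} (A E : Set (Fin d → ℤ)) : Set (Fin d → ℤ) :=
  (NSemi A : Set (Fin d → ℤ)) \ E

/-- `(a,F)` is a proper pair of `E`: a pair of `A` with `a + ℕF ⊆ std(E)`. -/
def ProperPair {d : ℕ} (A E : Set (Fin d → ℤ)) (a : Fin d → ℤ)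
    (F : Set (Fin d → ℤ)) : Prop :=
  a ∈ NSemi A ∧ IsFace A F ∧ cell a F ⊆ stdSet A E

/-- `(a,F)` is a standard pair of `E`: a proper pair of `E` maximal with respect to
the partial order `(a,F) ≼ (b,G) ↔ a + ℕF ⊆ b + ℕG`. -/
def StdPair {d : ℕ} (A E : Set (Fin d → ℤ)) (a : Fin d → ℤ)
    (F : Set (Fin d → ℤ)) : Prop :=
  ProperPair A E a F ∧
    ∀ b G, ProperPair A E b G → cell a F ⊆ cell b G → cell b G ⊆ cell a F

/-- The overlap class of the standard pair `(a,F)` of `E` is maximal with respect to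
divisibility among overlap classes of standard pairs of `E`. -/
def MaxClass {d : ℕ} (A E : Set (Fin d → ℤ)) (a : Fin d → ℤ)
    (F : Set (Fin d → ℤ)) : Prop :=
  ∀ b G, StdPair A E b G → PairDvd A a F b G → PairDvd A b G a F

noncomputable section

/-- The affine semigroup ring `k[ℕA]`. -/
abbrev SGRing {d : ℕ} (k : Type*) [Field k] (A : Set (Fin d → ℤ)) :=
  AddMonoidAlgebra k (NSemi A)

/-- The monomial `t^a` of `k[ℕA]`. -/
def mono {d : ℕ} (k : Type*) [Field k] (A : Set (Fin d → ℤ)) (a : (NSemi A)) :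
    SGRing k A :=
  AddMonoidAlgebra.single a 1

/-- `I` is a monomial ideal of `k[ℕA]`: an ideal generated by monomials. -/
def IsMonomialIdeal {d : ℕ} (k : Type*) [Field k] (A : Set (Fin d → ℤ))
    (I : Ideal (SGRing k A)) : Prop :=
  ∃ S : Set (NSemi A), I = Ideal.span ((fun a => mono k A a) '' S)

/-- The exponent set `E(I) = {a ∈ ℕA : t^a ∈ I}` of an ideal of `k[ℕA]`,
as a subset of `ℤ^d`. -/
def expSet {d : ℕ} (k : Type*) [Field k] (A : Set (Fin d → ℤ))
    (I : Ideal (SGRing k A)) : Set (Fin d → ℤ) :=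
  {x | ∃ h : x ∈ NSemi A, mono k A ⟨x, h⟩ ∈ I}

/-- The monomial prime ideal `p_F = ⟨t^a : a ∈ ℕA ∖ ℕF⟩` of `k[ℕA]`. -/
def primeF {d : ℕ} (k : Type*) [Field k] (A F : Set (Fin d → ℤ)) :
    Ideal (SGRing k A) :=
  Ideal.span {x | ∃ a : (NSemi A), (a : Fin d → ℤ) ∉ NSemi F ∧ x = mono k A a}

end


theorem toR_injective {d : ℕ} : Function.Injective (toR (d := d)) := by
  intro v w h
  funext i
  exact Int.cast_injective (congrFun h i)

theorem toR_add {d : ℕ} (v w : Fin d → ℤ) : toR (v + w) = toR v + toR w := by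
  funext i
  simp [toR]

theorem smul_mem_cone {d : ℕ} {S : Set (Fin d → ℤ)} {x : Fin d → ℝ} {r : ℝ}
    (hr : 0 ≤ r) (hx : x ∈ cone S) : r • x ∈ cone S := by
  obtain ⟨t, c, ht, hc, rfl⟩ := hx
  exact ⟨t, fun v => r * c v, ht, fun v => mul_nonneg hr (hc v), by
    simp only [Finset.smul_sum, smul_smul]⟩

theorem toR_mem_cone {d : ℕ} {S : Set (Fin d → ℤ)} {v : Fin d → ℤ}
    (hv : v ∈ NSemi S) : toR v ∈ cone S := by
  obtain ⟨f, t, ht, -, rfl⟩ := AddSubmonoid.mem_closure_iff_exists_finset_subset.1 hv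
  refine ⟨t, fun v => f v, ht, fun v => Nat.cast_nonneg _, ?_⟩
  funext i
  simp [toR]

/-- The semigroup of a face is divisor-closed. -/
theorem IsFace.mem_NSemi_of_add_mem_cone {d : ℕ} {A F : Set (Fin d → ℤ)} (hF : IsFace A F)
    {c : Fin d → ℤ} (hc : c ∈ NSemi A) :
    ∀ c' ∈ NSemi A, toR (c + c') ∈ cone F → c ∈ NSemi F := by
  induction hc using AddSubmonoid.closure_induction with
  | mem v hv =>
    intro c' hc' h
    have hmem : toR v ∈ cone F := by
      refine hF.2.1.2 (toR_mem_cone (AddSubmonoid.subset_closure hv)) (toR_mem_cone hc')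
        (smul_mem_cone (r := 1 / 2) (by norm_num) h) ⟨1 / 2, 1 / 2, by norm_num, by norm_num,
          by norm_num, ?_⟩
      rw [toR_add, smul_add]
    obtain ⟨w, hw, hwv⟩ : toR v ∈ toR '' F := hF.2.2 ▸ ⟨hmem, v, hv, rfl⟩
    exact toR_injective hwv ▸ AddSubmonoid.subset_closure hw
  | zero => exact fun _ _ _ => zero_mem _
  | add x y hx hy ihx ihy =>
    intro c' hc' h
    refine add_mem (ihx (y + c') (add_mem hy hc') ?_) (ihy (x + c') (add_mem hx hc') ?_)
    · rwa [← add_assoc]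
    · rwa [← add_assoc, add_comm y x]

theorem NSemi_le_ZGrp {d : ℕ} (S : Set (Fin d → ℤ)) :
    NSemi S ≤ (ZGrp S).toAddSubmonoid :=
  AddSubmonoid.closure_le.2 AddSubgroup.subset_closure

/-- Dickson's lemma for the divisibility order of a finitely generated monoid `ℕA`. -/
theorem exists_lt_sub_mem_NSemi {d : ℕ} {A : Set (Fin d → ℤ)} (hA : A.Finite)
    (u : ℕ → Fin d → ℤ) (hu : ∀ i, u i ∈ NSemi A) :
    ∃ i j, i < j ∧ u j - u i ∈ NSemi A := by
  have hfin : Finite A := hA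
  have : Fintype A := Fintype.ofFinite A
  choose n hn using fun i => AddSubmonoid.mem_closure_iff_of_fintype.1 (hu i)
  obtain ⟨i, j, hij, hle⟩ := wellQuasiOrdered_le n
  refine ⟨i, j, hij, ?_⟩
  have : u j - u i = ∑ v, (n j v - n i v) • (v : Fin d → ℤ) := by
    rw [hn i, hn j, sub_eq_iff_eq_add, ← Finset.sum_add_distrib]
    exact Finset.sum_congr rfl fun v _ => by rw [← add_smul, Nat.sub_add_cancel (hle v)]
  rw [this]
  exact sum_mem fun v _ => nsmul_mem (AddSubmonoid.subset_closure v.2) _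

/-- If the monomial ideal (exponent set) `E` has a standard pair
belonging to the face `F`, then any set of pairwise non-overlapping standard pairs
of `E` belonging to `F` whose overlap classes are maximal with respect to divisibility
is finite; i.e., there are finitely many maximal overlap classes belonging to `F`. -/
theorem finitely_many_maximal_overlap_classes {d : ℕ} (A : Set (Fin d → ℤ))
    (hA : IsConfig A) (E : Set (Fin d → ℤ)) (hE : IsExpSet A E)
    (F : Set (Fin d → ℤ)) (hF : IsFace A F) (hex : ∃ a, StdPair A E a F)
    (T : Set (Fin d → ℤ))
    (hT : ∀ a ∈ T, StdPair A E a F ∧ MaxClass A E a F)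
    (hno : ∀ a ∈ T, ∀ b ∈ T, a ≠ b → ¬ Overlap F a b) :
    T.Finite := by
  by_contra hinf
  let u := Set.Infinite.natEmbedding T hinf
  obtain ⟨i, j, hij, hc⟩ := exists_lt_sub_mem_NSemi hA.finite (fun i => (u i : Fin d → ℤ))
    fun i => (hT _ (u i).2).1.1.1
  obtain ⟨c', hc', hsub⟩ := (hT _ (u i).2).2 _ F (hT _ (u j).2).1
    ⟨_, hc, by rw [add_sub_cancel]⟩
  obtain ⟨f, hf, hfeq⟩ := hsub ⟨0, zero_mem _, (add_zero _).symm⟩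
  have hsum : (u j - u i : Fin d → ℤ) + c' = f := by
    rw [sub_add_eq_add_sub, hfeq, add_sub_cancel_left]
  have hmem := hF.mem_NSemi_of_add_mem_cone hc c' hc' (hsum ▸ toR_mem_cone hf)
  exact hno _ (u j).2 _ (u i).2
    (fun h => hij.ne' (u.injective (Subtype.ext h))) (NSemi_le_ZGrp F hmem)

end StdPairsPaper
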